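/- arXiv:1608.02910 — 5 statements merged into one kernel-verified Lean document; each statement's English description precedes it below -/
import Mathlib

section
/- Let μ, V : ℝ → ℝ be smooth (at least C³) with μ(x) > 0 for all x in K(E*) = {x : V(x) ≤ E*}, V(0) = 0, V'(0) = 0, V''(0) > 0, and suppose K(E*) is a compact interval [a,b] with a < 0 < b, V'(x) < 0 on (a,0) and V'(x) > 0 on (0,b). For E ∈ (0,E*) let x₋(E) ∈ (a,0) and x₊(E) ∈ (0,b) be the unique points with V(x₋(E)) = V(x₊(E)) = E, and define the period function T(E) = √2 ∫_{x₋(E)}^{x₊(E)} √(μ(x)) / √(E − V(x)) dx. If N(x) ≥ 0 for all x ∈ K(E*) with x ≠ 0, then T is monotonically non-decreasing on (0,E*): E₁ ≤ E₂ implies T(E₁) ≤ T(E₂). -/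
/-- The function `N(x) = ((V/V'²)·√μ)'' + ((V/V'²)·(√μ)')'` governing the
monotonicity of the period function of `H = p²/(2μ(x)) + V(x)`. -/
noncomputable def NFun (μ V : ℝ → ℝ) (x : ℝ) : ℝ :=
  deriv (deriv (fun y => (V y / (deriv V y) ^ 2) * Real.sqrt (μ y))) x
    + deriv (fun y => (V y / (deriv V y) ^ 2) * deriv (fun z => Real.sqrt (μ z)) y) x

open Set Filter Topology MeasureTheory

/-- The primitive `((V/V'²)·m)' + (V/V'²)·m'` of the function `N`, with `m = √μ`. -/
noncomputable def NPrimitive (m V : ℝ → ℝ) (x : ℝ) : ℝ :=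
  deriv (fun y => V y / (deriv V y) ^ 2 * m y) x + V x / (deriv V x) ^ 2 * deriv m x

lemma contDiff_deriv {n : WithTop ℕ∞} {V : ℝ → ℝ} (hV : ContDiff ℝ (n + 1) V) :
    ContDiff ℝ n (deriv V) :=
  (contDiff_succ_iff_deriv.1 hV).2.2

lemma hasDerivAt_div_deriv_sq {V : ℝ → ℝ} (hV : ContDiff ℝ 3 V) {x : ℝ} (hx : deriv V x ≠ 0) :
    HasDerivAt (fun y => V y / (deriv V y) ^ 2)
      (((deriv V x) ^ 2 - 2 * V x * deriv (deriv V) x) / (deriv V x) ^ 3) x := by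
  have hV' : ContDiff ℝ 2 (deriv V) := contDiff_deriv (by norm_num; exact hV)
  have h0 := (hV.differentiable (by norm_num) x).hasDerivAt
  have h1 := (hV'.differentiable (by norm_num) x).hasDerivAt
  refine (h0.div (h1.pow 2) (pow_ne_zero 2 hx)).congr_deriv ?_
  simp only [Pi.pow_apply]
  field_simp
  norm_num
  ring

lemma nPrimitive_eq {m V : ℝ → ℝ} (hV : ContDiff ℝ 3 V) {x : ℝ} (hm : DifferentiableAt ℝ m x)
    (hx : deriv V x ≠ 0) :
    NPrimitive m V x = 2 * (V x / (deriv V x) ^ 2) * deriv m x +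
      ((deriv V x) ^ 2 - 2 * V x * deriv (deriv V) x) / (deriv V x) ^ 3 * m x := by
  have h : HasDerivAt (fun y => V y / (deriv V y) ^ 2 * m y) _ x :=
    (hasDerivAt_div_deriv_sq hV hx).mul hm.hasDerivAt
  rw [NPrimitive, h.deriv]
  ring

lemma hasDerivAt_nPrimitive {μ V : ℝ → ℝ} (hV : ContDiff ℝ 3 V) {x : ℝ}
    (hμ : ContDiffAt ℝ 3 (fun z => √(μ z)) x) (hx : deriv V x ≠ 0) :
    HasDerivAt (NPrimitive (fun z => √(μ z)) V) (NFun μ V x) x := by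
  have hV' : ContDiff ℝ 2 (deriv V) := contDiff_deriv (by norm_num; exact hV)
  have hW : ContDiffAt ℝ 2 (fun y => V y / (deriv V y) ^ 2) x :=
    (hV.of_le (by norm_num)).contDiffAt.div (hV'.contDiffAt.pow 2) (pow_ne_zero 2 hx)
  have h1 : ContDiffAt ℝ 1 (deriv fun y => V y / (deriv V y) ^ 2 * √(μ y)) x :=
    (hW.mul (hμ.of_le (by norm_num))).derivWithin (by norm_num)
  have h2 : ContDiffAt ℝ 1 (deriv fun z => √(μ z)) x := hμ.derivWithin (by norm_num)
  have h3 : ContDiffAt ℝ 1 (fun y => V y / (deriv V y) ^ 2 * deriv (fun z => √(μ z)) y) x :=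
    (hW.of_le (by norm_num)).mul h2
  exact (h1.differentiableAt (by norm_num)).hasDerivAt.add
    (h3.differentiableAt (by norm_num)).hasDerivAt

lemma monotoneOn_nPrimitive {μ V : ℝ → ℝ} (hV : ContDiff ℝ 3 V) {J : Set ℝ} (hJ : IsOpen J)
    (hJc : Convex ℝ J) (hμ : ∀ x ∈ J, ContDiffAt ℝ 3 (fun z => √(μ z)) x)
    (hV' : ∀ x ∈ J, deriv V x ≠ 0) (hN : ∀ x ∈ J, 0 ≤ NFun μ V x) :
    MonotoneOn (NPrimitive (fun z => √(μ z)) V) J := by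
  have hd := fun x hx => hasDerivAt_nPrimitive hV (hμ x hx) (hV' x hx)
  refine monotoneOn_of_deriv_nonneg hJc (fun x hx => (hd x hx).continuousAt.continuousWithinAt)
    ?_ ?_ <;> rw [hJ.interior_eq]
  · exact fun x hx => (hd x hx).differentiableAt.differentiableWithinAt
  · exact fun x hx => (hd x hx).deriv ▸ hN x hx

/-- At a nondegenerate critical point of `V` the primitive of `N` has a two-sided limit. -/
lemma exists_tendsto_nPrimitive {m V : ℝ → ℝ} (hV : ContDiff ℝ 3 V) (hm : ContDiffAt ℝ 3 m 0)
    (hV0 : V 0 = 0) (hV'0 : deriv V 0 = 0) (hV''0 : deriv (deriv V) 0 ≠ 0)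
    (hV' : ∀ᶠ x in 𝓝[≠] 0, deriv V x ≠ 0) :
    ∃ L, Tendsto (NPrimitive m V) (𝓝[≠] 0) (𝓝 L) := by
  have hC1 : ContDiff ℝ 2 (deriv V) := contDiff_deriv (by norm_num; exact hV)
  have hC2 : ContDiff ℝ 1 (deriv (deriv V)) := contDiff_deriv (by norm_num; exact hC1)
  have hC3 : ContDiff ℝ 0 (deriv (deriv (deriv V))) := contDiff_deriv (by norm_num; exact hC2)
  have hd0 := fun x => (hV.differentiable (by norm_num) x).hasDerivAt
  have hd1 := fun x => (hC1.differentiable (by norm_num) x).hasDerivAt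
  have hd2 := fun x => (hC2.differentiable (by norm_num) x).hasDerivAt
  have lim : ∀ f : ℝ → ℝ, Continuous f → Tendsto f (𝓝[≠] 0) (𝓝 (f 0)) :=
    fun f hf => hf.continuousAt.tendsto.mono_left nhdsWithin_le_nhds
  have lim0 : ∀ f : ℝ → ℝ, Continuous f → f 0 = 0 → Tendsto f (𝓝[≠] 0) (𝓝 0) :=
    fun f hf h0 => by simpa [h0] using lim f hf
  have hne2 : ∀ᶠ x in 𝓝[≠] 0, deriv (deriv V) x ≠ 0 :=
    (lim _ hC2.continuous).eventually_ne hV''0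
  have hlimW : Tendsto (fun x => V x / (deriv V x) ^ 2) (𝓝[≠] 0)
      (𝓝 (1 / (2 * deriv (deriv V) 0))) := by
    refine HasDerivAt.lhopital_zero_nhdsNE (.of_forall hd0)
      (.of_forall fun x => (hd1 x).pow 2) ?_ ?_ ?_ ?_
    · filter_upwards [hV', hne2] with x h1 h2
      simp [h1, h2]
    · exact lim0 _ hV.continuous hV0
    · exact lim0 _ (hC1.continuous.pow 2) (by simp [hV'0])
    · refine (tendsto_const_nhds.div ((lim _ hC2.continuous).const_mul 2)
        (by simpa using hV''0)).congr' ?_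
      filter_upwards [hV', hne2] with x h1 h2
      field_simp
      norm_num
      field_simp
  have hlimW' : Tendsto
      (fun x => ((deriv V x) ^ 2 - 2 * V x * deriv (deriv V) x) / (deriv V x) ^ 3) (𝓝[≠] 0)
      (𝓝 (1 / (2 * deriv (deriv V) 0) *
        (-2 * deriv (deriv (deriv V)) 0 / (3 * deriv (deriv V) 0)))) := by
    refine HasDerivAt.lhopital_zero_nhdsNE
      (.of_forall fun x => ((hd1 x).pow 2).sub (((hd0 x).const_mul 2).mul (hd2 x)))
      (.of_forall fun x => (hd1 x).pow 3) ?_ ?_ ?_ ?_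
    · filter_upwards [hV', hne2] with x h1 h2
      simp [h1, h2]
    · exact lim0 _ ((hC1.continuous.pow 2).sub
        ((hV.continuous.const_mul 2).mul hC2.continuous)) (by simp [hV0, hV'0])
    · exact lim0 _ (hC1.continuous.pow 3) (by simp [hV'0])
    · refine (hlimW.mul (((lim _ hC3.continuous).const_mul (-2)).div
        ((lim _ hC2.continuous).const_mul 3) (by simpa using hV''0))).congr' ?_
      filter_upwards [hV', hne2] with x h1 h2
      field_simp
      norm_num
      field_simp
      ring
  have hm' : ContDiffAt ℝ 2 (deriv m) 0 := hm.derivWithin (by norm_num)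
  have hlim := ((hlimW.const_mul 2).mul
    (hm'.continuousAt.tendsto.mono_left nhdsWithin_le_nhds)).add
    (hlimW'.mul (hm.continuousAt.tendsto.mono_left nhdsWithin_le_nhds))
  refine ⟨_, hlim.congr' ?_⟩
  filter_upwards [hV', ((hm.of_le (m := 1) (by norm_num)).eventually (by simp)).filter_mono
    nhdsWithin_le_nhds] with x h1 h2
  exact (nPrimitive_eq hV (h2.differentiableAt (by norm_num)) h1).symm

lemma hasDerivAt_of_right_inverse {V x : ℝ → ℝ} (hV : ContDiff ℝ 3 V) {J : Set ℝ} (hJ : IsOpen J)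
    (hinj : InjOn V J) {s : ℝ} (hx : ∀ᶠ t in 𝓝 s, x t ∈ J ∧ V (x t) = t)
    (h' : deriv V (x s) ≠ 0) : HasDerivAt x (deriv V (x s))⁻¹ s := by
  obtain ⟨hxJ, hVx⟩ := hx.self_of_nhds
  have hs : HasStrictDerivAt V (deriv V (x s)) (x s) :=
    hV.contDiffAt.hasStrictDerivAt (by norm_num)
  have hg := (hs.to_localInverse h').hasDerivAt
  have hgs : hs.localInverse V _ _ h' (V (x s)) = x s :=
    HasStrictFDerivAt.localInverse_apply_image ..
  have hgJ := hg.continuousAt.eventually_mem (hgs.symm ▸ hJ.mem_nhds hxJ)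
  have hgV := hs.eventually_right_inverse h'
  rw [hVx] at hg hgJ hgV
  refine hg.congr_of_eventuallyEq ?_
  filter_upwards [hx, hgJ, hgV] with t h1 h2 h3
  exact hinj h1.1 h2 (h1.2.trans h3.symm)

/-- Twice the derivative of `√V·m/V'` along a branch of `V⁻¹` is the primitive of `N` over `√V`. -/
lemma hasDerivAt_mul_sqrt_div_deriv {m V x : ℝ → ℝ} (hV : ContDiff ℝ 3 V) {s : ℝ} (hs : 0 < s)
    (hx : HasDerivAt x (deriv V (x s))⁻¹ s) (hVx : V (x s) = s)
    (hm : DifferentiableAt ℝ m (x s)) (h' : deriv V (x s) ≠ 0) :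
    HasDerivAt (fun t => m (x t) * √t / deriv V (x t)) (NPrimitive m V (x s) / (2 * √s)) s := by
  have hV' : ContDiff ℝ 2 (deriv V) := contDiff_deriv (by norm_num; exact hV)
  have h1 := (hV'.differentiable (by norm_num) (x s)).hasDerivAt
  have hsq := Real.sqrt_pos.2 hs
  refine (((hm.hasDerivAt.comp s hx).mul (Real.hasDerivAt_sqrt hs.ne')).div
    (h1.comp s hx) h').congr_deriv ?_
  rw [nPrimitive_eq hV hm h', hVx]
  obtain ⟨r, hr⟩ : ∃ r, r = √s := ⟨_, rfl⟩
  have hs2 : s = r ^ 2 := by rw [hr, Real.sq_sqrt hs.le]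
  simp only [Function.comp, Pi.mul_apply]
  rw [← hr] at hsq ⊢
  generalize m (x s) = a, deriv m (x s) = b, deriv V (x s) = c, deriv (deriv V) (x s) = d at *
  rw [hs2]
  field_simp
  ring

lemma integrableOn_one_div_sqrt_mul_sqrt :
    IntegrableOn (fun u : ℝ => 1 / (√u * √(1 - u))) (Ioo 0 1) := by
  have h1 : IntervalIntegrable (fun u : ℝ => 1 / √u) volume 0 1 := by
    refine (intervalIntegral.intervalIntegrable_rpow' (r := -(1 / 2)) (by norm_num)).congr ?_
    intro u hu
    rw [uIoc_of_le zero_le_one] at hu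
    simp only [Real.rpow_neg hu.1.le, Real.sqrt_eq_rpow, one_div]
  have h2 : IntervalIntegrable (fun u : ℝ => 1 / √(1 - u)) volume 0 1 := by
    simpa using (h1.comp_sub_left 1).symm
  refine ((h1.add h2).1.mono_set Ioo_subset_Ioc_self).mono'
    (by fun_prop : Measurable fun u : ℝ => 1 / (√u * √(1 - u))).aestronglyMeasurable ?_
  filter_upwards [ae_restrict_mem measurableSet_Ioo] with u hu
  have hu0 := Real.sqrt_pos.2 hu.1
  have hu1 := Real.sqrt_pos.2 (sub_pos.2 hu.2)
  have e0 := Real.sq_sqrt hu.1.le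
  have e1 := Real.sq_sqrt (sub_pos.2 hu.2).le
  rw [Real.norm_of_nonneg (by positivity), div_add_div _ _ hu0.ne' hu1.ne']
  gcongr
  nlinarith [mul_pos hu0 hu1]

lemma integral_branch {m V x : ℝ → ℝ} {E : ℝ} (hE : 0 < E)
    (hx : ∀ s ∈ Ioo 0 E, HasDerivAt x (deriv V (x s))⁻¹ s) (hVx : ∀ s ∈ Ioo 0 E, V (x s) = s)
    (hm : ∀ s ∈ Ioo 0 E, 0 ≤ m (x s))
    (hint : IntegrableOn (fun u => |m (x (E * u)) * √(E * u) / deriv V (x (E * u))| *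
      (1 / (√u * √(1 - u)))) (Ioo 0 1)) :
    IntegrableOn (fun y => m y / √(E - V y)) (x '' Ioo 0 E) ∧
    ∫ y in x '' Ioo 0 E, m y / √(E - V y) =
      ∫ u in Ioo 0 1, |m (x (E * u)) * √(E * u) / deriv V (x (E * u))| *
        (1 / (√u * √(1 - u))) := by
  have himg : (E * ·) '' Ioo 0 1 = Ioo 0 E := by
    rw [image_mul_left_Ioo hE]; simp
  have hmem : ∀ u ∈ Ioo (0 : ℝ) 1, E * u ∈ Ioo 0 E := fun u hu => himg ▸ mem_image_of_mem _ hu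
  have hd : ∀ u ∈ Ioo (0 : ℝ) 1, HasDerivWithinAt (fun u => x (E * u))
      ((deriv V (x (E * u)))⁻¹ * E) (Ioo 0 1) u := fun u hu =>
    ((hx _ (hmem u hu)).comp u (by simpa using (hasDerivAt_id u).const_mul E)).hasDerivWithinAt
  have hinj : InjOn (fun u => x (E * u)) (Ioo 0 1) := fun u hu v hv huv => by
    have := congrArg V huv
    simp only [hVx _ (hmem u hu), hVx _ (hmem v hv)] at this
    exact mul_left_cancel₀ hE.ne' this
  have heq : EqOn (fun u => |(deriv V (x (E * u)))⁻¹ * E| • (m (x (E * u)) / √(E - V (x (E * u)))))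
      (fun u => |m (x (E * u)) * √(E * u) / deriv V (x (E * u))| * (1 / (√u * √(1 - u))))
      (Ioo 0 1) := fun u hu => by
    have hE' : E = √E ^ 2 := (Real.sq_sqrt hE.le).symm
    have hs := Real.sqrt_pos.2 hE
    have hu0 := Real.sqrt_pos.2 hu.1
    have hu1 := Real.sqrt_pos.2 (sub_pos.2 hu.2)
    simp only [hVx _ (hmem u hu), smul_eq_mul]
    rw [show E - E * u = E * (1 - u) by ring, Real.sqrt_mul hE.le, Real.sqrt_mul hE.le,
      abs_div, abs_mul, abs_mul, abs_inv, abs_of_nonneg (hm _ (hmem u hu)), abs_of_pos hE,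
      abs_of_pos (mul_pos hs hu0)]
    generalize m (x (E * u)) = c, |deriv V (x (E * u))| = d
    nth_rewrite 1 [hE']
    field_simp
  rw [← himg, image_image, integrableOn_image_iff_integrableOn_abs_deriv_smul measurableSet_Ioo hd
    hinj, integral_image_eq_integral_abs_deriv_smul measurableSet_Ioo hd hinj]
  exact ⟨hint.congr_fun heq.symm measurableSet_Ioo,
    setIntegral_congr_fun measurableSet_Ioo heq⟩

/-- If `N ≥ 0` on `K(E*) \ {0}` then the period function is monotonically
non-decreasing on `(0, E*)`. -/
theorem period_monotone_nondecreasing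
    (μ V : ℝ → ℝ) (Estar a b : ℝ)
    (hμ : ContDiff ℝ 3 μ) (hV : ContDiff ℝ 3 V)
    (ha : a < 0) (hb : 0 < b)
    (hK : {x : ℝ | V x ≤ Estar} = Set.Icc a b)
    (hμpos : ∀ x ∈ Set.Icc a b, 0 < μ x)
    (hV0 : V 0 = 0) (hV'0 : deriv V 0 = 0) (hV''0 : 0 < deriv (deriv V) 0)
    (hV'neg : ∀ x ∈ Set.Ioo a 0, deriv V x < 0)
    (hV'pos : ∀ x ∈ Set.Ioo 0 b, 0 < deriv V x)
    (xm xp : ℝ → ℝ)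
    (hxm : ∀ E ∈ Set.Ioo 0 Estar, xm E ∈ Set.Ioo a 0 ∧ V (xm E) = E)
    (hxp : ∀ E ∈ Set.Ioo 0 Estar, xp E ∈ Set.Ioo 0 b ∧ V (xp E) = E)
    (T : ℝ → ℝ)
    (hT : ∀ E ∈ Set.Ioo 0 Estar,
      T E = Real.sqrt 2 * ∫ x in xm E..xp E, Real.sqrt (μ x) / Real.sqrt (E - V x))
    (hN : ∀ x ∈ Set.Icc a b, x ≠ 0 → 0 ≤ NFun μ V x) :
    ∀ E₁ ∈ Set.Ioo 0 Estar, ∀ E₂ ∈ Set.Ioo 0 Estar, E₁ ≤ E₂ → T E₁ ≤ T E₂ := by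
  have hVc : Continuous V := hV.continuous
  have hC1 : ContDiff ℝ 2 (deriv V) := contDiff_deriv (by norm_num; exact hV)
  set m : ℝ → ℝ := fun z => √(μ z)
  have hm : ∀ x ∈ Icc a b, ContDiffAt ℝ 3 m x := fun x hx =>
    hμ.contDiffAt.sqrt (hμpos x hx).ne'
  have hmd : ∀ x ∈ Icc a b, DifferentiableAt ℝ m x := fun x hx =>
    (hm x hx).differentiableAt (by norm_num)
  have hmp : ∀ x ∈ Icc a b, 0 < m x := fun x hx => Real.sqrt_pos.2 (hμpos x hx)
  have hL : Ioo a 0 ⊆ Icc a b := fun x hx => ⟨hx.1.le, hx.2.le.trans hb.le⟩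
  have hR : Ioo 0 b ⊆ Icc a b := fun x hx => ⟨ha.le.trans hx.1.le, hx.2.le⟩
  have hanti : StrictAntiOn V (Icc a 0) := strictAntiOn_of_deriv_neg (convex_Icc a 0)
    hVc.continuousOn (by simpa [interior_Icc] using hV'neg)
  have hmono : StrictMonoOn V (Icc 0 b) := strictMonoOn_of_deriv_pos (convex_Icc 0 b)
    hVc.continuousOn (by simpa [interior_Icc] using hV'pos)
  -- the primitive of `N` on the right branch dominates that on the left branch
  have hP : ∀ y ∈ Ioo a 0, ∀ z ∈ Ioo 0 b, NPrimitive m V y ≤ NPrimitive m V z := by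
    have hne : ∀ᶠ x in 𝓝[≠] (0 : ℝ), deriv V x ≠ 0 := by
      filter_upwards [self_mem_nhdsWithin,
        nhdsWithin_le_nhds (Ioo_mem_nhds ha hb)] with x hx0 hx
      rcases lt_or_gt_of_ne hx0 with h | h
      · exact (hV'neg x ⟨hx.1, h⟩).ne
      · exact (hV'pos x ⟨h, hx.2⟩).ne'
    obtain ⟨L, hlim⟩ := exists_tendsto_nPrimitive hV (hm 0 ⟨ha.le, hb.le⟩) hV0 hV'0 hV''0.ne' hne
    have hPl : MonotoneOn (NPrimitive m V) (Ioo a 0) :=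
      monotoneOn_nPrimitive hV isOpen_Ioo (convex_Ioo a 0) (fun x hx => hm x (hL hx))
        (fun x hx => (hV'neg x hx).ne) (fun x hx => hN x (hL hx) hx.2.ne)
    have hPr : MonotoneOn (NPrimitive m V) (Ioo 0 b) :=
      monotoneOn_nPrimitive hV isOpen_Ioo (convex_Ioo 0 b) (fun x hx => hm x (hR hx))
        (fun x hx => (hV'pos x hx).ne') (fun x hx => hN x (hR hx) hx.1.ne')
    intro y hy z hz
    refine le_trans (b := L) ?_ ?_
    · refine ge_of_tendsto (hlim.mono_left (nhdsLT_le_nhdsNE 0)) ?_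
      filter_upwards [Ioo_mem_nhdsLT hy.2] with x hx
      exact hPl hy ⟨hy.1.trans hx.1, hx.2⟩ hx.1.le
    · refine le_of_tendsto (hlim.mono_left (nhdsGT_le_nhdsNE 0)) ?_
      filter_upwards [Ioo_mem_nhdsGT hz.1] with x hx
      exact hPr ⟨hx.1, hx.2.trans hz.2⟩ hz hx.2.le
  have hdm : ∀ s ∈ Ioo 0 Estar, HasDerivAt xm (deriv V (xm s))⁻¹ s := fun s hs =>
    hasDerivAt_of_right_inverse hV isOpen_Ioo (hanti.injOn.mono Ioo_subset_Icc_self)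
      (by filter_upwards [Ioo_mem_nhds hs.1 hs.2] with t ht using hxm t ht)
      (hV'neg _ (hxm s hs).1).ne
  have hdp : ∀ s ∈ Ioo 0 Estar, HasDerivAt xp (deriv V (xp s))⁻¹ s := fun s hs =>
    hasDerivAt_of_right_inverse hV isOpen_Ioo (hmono.injOn.mono Ioo_subset_Icc_self)
      (by filter_upwards [Ioo_mem_nhds hs.1 hs.2] with t ht using hxp t ht)
      (hV'pos _ (hxp s hs).1).ne'
  set Gm : ℝ → ℝ := fun t => m (xm t) * √t / deriv V (xm t)
  set Gp : ℝ → ℝ := fun t => m (xp t) * √t / deriv V (xp t)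
  have hGmd : ∀ s ∈ Ioo 0 Estar, HasDerivAt Gm (NPrimitive m V (xm s) / (2 * √s)) s := fun s hs =>
    hasDerivAt_mul_sqrt_div_deriv hV hs.1 (hdm s hs) (hxm s hs).2 (hmd _ (hL (hxm s hs).1))
      (hV'neg _ (hxm s hs).1).ne
  have hGpd : ∀ s ∈ Ioo 0 Estar, HasDerivAt Gp (NPrimitive m V (xp s) / (2 * √s)) s := fun s hs =>
    hasDerivAt_mul_sqrt_div_deriv hV hs.1 (hdp s hs) (hxp s hs).2 (hmd _ (hR (hxp s hs).1))
      (hV'pos _ (hxp s hs).1).ne'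
  have hGm0 : ∀ s ∈ Ioo 0 Estar, Gm s ≤ 0 := fun s hs =>
    div_nonpos_of_nonneg_of_nonpos
      (mul_nonneg (hmp _ (hL (hxm s hs).1)).le (Real.sqrt_nonneg s)) (hV'neg _ (hxm s hs).1).le
  have hGp0 : ∀ s ∈ Ioo 0 Estar, 0 ≤ Gp s := fun s hs =>
    div_nonneg
      (mul_nonneg (hmp _ (hR (hxp s hs).1)).le (Real.sqrt_nonneg s)) (hV'pos _ (hxp s hs).1).le
  have hGmono : MonotoneOn (fun s => |Gm s| + |Gp s|) (Ioo 0 Estar) := by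
    have hd := fun s hs => (hGpd s hs).sub (hGmd s hs)
    have h : MonotoneOn (Gp - Gm) (Ioo 0 Estar) := by
      refine monotoneOn_of_deriv_nonneg (convex_Ioo 0 Estar)
        (fun s hs => (hd s hs).continuousAt.continuousWithinAt) ?_ ?_ <;> rw [interior_Ioo]
      · exact fun s hs => (hd s hs).differentiableAt.differentiableWithinAt
      · intro s hs
        rw [(hd s hs).deriv, ← sub_div]
        exact div_nonneg (sub_nonneg.2 (hP _ (hxm s hs).1 _ (hxp s hs).1)) (by positivity)
    refine h.congr fun s hs => ?_
    simp only [Pi.sub_apply, abs_of_nonpos (hGm0 s hs), abs_of_nonneg (hGp0 s hs)]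
    ring
  have hmem : ∀ E ∈ Ioo 0 Estar, ∀ u ∈ Ioo (0 : ℝ) 1, E * u ∈ Ioo 0 E ∧ E * u ∈ Ioo 0 Estar := by
    intro E hE u hu
    have h1 : E * u < E := mul_lt_of_lt_one_right hE.1 hu.2
    exact ⟨⟨mul_pos hE.1 hu.1, h1⟩, mul_pos hE.1 hu.1, h1.trans hE.2⟩
  have hint : ∀ E ∈ Ioo 0 Estar, ∀ G : ℝ → ℝ, ContinuousOn G (Ioo 0 Estar) →
      (∀ s ∈ Ioo 0 Estar, |G s| ≤ |Gm s| + |Gp s|) →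
      IntegrableOn (fun u => |G (E * u)| * (1 / (√u * √(1 - u)))) (Ioo 0 1) := by
    intro E hE G hG hGle
    refine integrableOn_one_div_sqrt_mul_sqrt.bdd_mul (c := |Gm E| + |Gp E|) ?_ ?_
    · refine ContinuousOn.aestronglyMeasurable ?_ measurableSet_Ioo
      exact (hG.comp (by fun_prop) fun u hu => (hmem E hE u hu).2).abs
    · filter_upwards [ae_restrict_mem measurableSet_Ioo] with u hu
      have h := hmem E hE u hu
      rw [Real.norm_of_nonneg (abs_nonneg _)]
      exact (hGle _ h.2).trans (hGmono h.2 hE h.1.2.le)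
  have hintm : ∀ E ∈ Ioo 0 Estar,
      IntegrableOn (fun u => |Gm (E * u)| * (1 / (√u * √(1 - u)))) (Ioo 0 1) := fun E hE =>
    hint E hE Gm (fun s hs => (hGmd s hs).continuousAt.continuousWithinAt)
      fun s _ => le_add_of_nonneg_right (abs_nonneg _)
  have hintp : ∀ E ∈ Ioo 0 Estar,
      IntegrableOn (fun u => |Gp (E * u)| * (1 / (√u * √(1 - u)))) (Ioo 0 1) := fun E hE =>
    hint E hE Gp (fun s hs => (hGpd s hs).continuousAt.continuousWithinAt)
      fun s _ => le_add_of_nonneg_left (abs_nonneg _)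
  have himm : ∀ E ∈ Ioo 0 Estar, xm '' Ioo 0 E = Ioo (xm E) 0 := by
    intro E hE
    obtain ⟨hxE, hVE⟩ := hxm E hE
    ext y
    constructor
    · rintro ⟨s, hs, rfl⟩
      obtain ⟨hxs, hVs⟩ := hxm s ⟨hs.1, hs.2.trans hE.2⟩
      refine ⟨(hanti.lt_iff_gt (Ioo_subset_Icc_self hxs) (Ioo_subset_Icc_self hxE)).1 ?_, hxs.2⟩
      rw [hVs, hVE]; exact hs.2
    · intro hy
      have hya : y ∈ Icc a 0 := ⟨hxE.1.le.trans hy.1.le, hy.2.le⟩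
      have h0 : 0 < V y := hV0 ▸ hanti hya (right_mem_Icc.2 ha.le) hy.2
      have h1 : V y < E := hVE ▸ hanti (Ioo_subset_Icc_self hxE) hya hy.1
      obtain ⟨hxs, hVs⟩ := hxm (V y) ⟨h0, h1.trans hE.2⟩
      exact ⟨V y, ⟨h0, h1⟩, hanti.injOn (Ioo_subset_Icc_self hxs) hya hVs⟩
  have himp : ∀ E ∈ Ioo 0 Estar, xp '' Ioo 0 E = Ioo 0 (xp E) := by
    intro E hE
    obtain ⟨hxE, hVE⟩ := hxp E hE
    ext y
    constructor
    · rintro ⟨s, hs, rfl⟩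
      obtain ⟨hxs, hVs⟩ := hxp s ⟨hs.1, hs.2.trans hE.2⟩
      refine ⟨hxs.1, (hmono.lt_iff_lt (Ioo_subset_Icc_self hxs) (Ioo_subset_Icc_self hxE)).1 ?_⟩
      rw [hVs, hVE]; exact hs.2
    · intro hy
      have hyb : y ∈ Icc 0 b := ⟨hy.1.le, hy.2.le.trans hxE.2.le⟩
      have h0 : 0 < V y := hV0 ▸ hmono (left_mem_Icc.2 hb.le) hyb hy.1
      have h1 : V y < E := hVE ▸ hmono hyb (Ioo_subset_Icc_self hxE) hy.2
      obtain ⟨hxs, hVs⟩ := hxp (V y) ⟨h0, h1.trans hE.2⟩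
      exact ⟨V y, ⟨h0, h1⟩, hmono.injOn (Ioo_subset_Icc_self hxs) hyb hVs⟩
  have hTE : ∀ E ∈ Ioo 0 Estar, T E =
      √2 * ∫ u in Ioo 0 1, (|Gm (E * u)| + |Gp (E * u)|) * (1 / (√u * √(1 - u))) := by
    intro E hE
    have hs : ∀ s ∈ Ioo 0 E, s ∈ Ioo 0 Estar := fun s hs => ⟨hs.1, hs.2.trans hE.2⟩
    obtain ⟨hi₁, he₁⟩ := integral_branch hE.1 (fun s h => hdm s (hs s h))
      (fun s h => (hxm s (hs s h)).2) (fun s h => (hmp _ (hL (hxm s (hs s h)).1)).le) (hintm E hE)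
    obtain ⟨hi₂, he₂⟩ := integral_branch hE.1 (fun s h => hdp s (hs s h))
      (fun s h => (hxp s (hs s h)).2) (fun s h => (hmp _ (hR (hxp s (hs s h)).1)).le) (hintp E hE)
    rw [himm E hE] at hi₁ he₁
    rw [himp E hE] at hi₂ he₂
    have hxm0 := (hxm E hE).1.2.le
    have hxp0 := (hxp E hE).1.1.le
    simp only [add_mul]
    rw [hT E hE, ← intervalIntegral.integral_add_adjacent_intervals (b := 0)
      ((intervalIntegrable_iff_integrableOn_Ioo_of_le hxm0).2 hi₁)
      ((intervalIntegrable_iff_integrableOn_Ioo_of_le hxp0).2 hi₂),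
      intervalIntegral.integral_of_le hxm0, intervalIntegral.integral_of_le hxp0,
      integral_Ioc_eq_integral_Ioo, integral_Ioc_eq_integral_Ioo,
      integral_add (hintm E hE) (hintp E hE), ← he₁, ← he₂]
  intro E₁ hE₁ E₂ hE₂ hle
  rw [hTE E₁ hE₁, hTE E₂ hE₂]
  have hi : ∀ E ∈ Ioo 0 Estar, IntegrableOn
      (fun u => (|Gm (E * u)| + |Gp (E * u)|) * (1 / (√u * √(1 - u)))) (Ioo 0 1) := fun E hE => by
    simp only [add_mul]; exact (hintm E hE).add (hintp E hE)
  refine mul_le_mul_of_nonneg_left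
    (setIntegral_mono_on (hi E₁ hE₁) (hi E₂ hE₂) measurableSet_Ioo fun u hu => ?_)
    (Real.sqrt_nonneg 2)
  exact mul_le_mul_of_nonneg_right (hGmono (hmem E₁ hE₁ u hu).2 (hmem E₂ hE₂ u hu).2
    (mul_le_mul_of_nonneg_right hle hu.1.le)) (by positivity)
end

section
/- Let μ, V : ℝ → ℝ be smooth (at least C³) with μ(x) > 0 for all x in K(E*) = {x : V(x) ≤ E*}, V(0) = 0, V'(0) = 0, V''(0) > 0, and suppose K(E*) is a compact interval [a,b] with a < 0 < b, V'(x) < 0 on (a,0) and V'(x) > 0 on (0,b). For E ∈ (0,E*) let x₋(E) ∈ (a,0) and x₊(E) ∈ (0,b) be the unique points with V(x₋(E)) = V(x₊(E)) = E, and define the period function T(E) = √2 ∫_{x₋(E)}^{x₊(E)} √(μ(x)) / √(E − V(x)) dx. If N(x) ≤ 0 for all x ∈ K(E*) with x ≠ 0, then T is monotonically non-increasing on (0,E*): E₁ ≤ E₂ implies T(E₁) ≥ T(E₂). -/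
namespace PeriodMonotone

open Set Filter Topology MeasureTheory

lemma integrableOn_inv_sqrt_mul_one_sub :
    IntegrableOn (fun s : ℝ => (√(s * (1 - s)))⁻¹) (Ioo 0 1) := by
  refine IntegrableOn.mono_set (intervalIntegral.integrableOn_deriv_of_nonneg
    (g := fun s => Real.arcsin (2 * s - 1)) (a := 0) (b := 1) ?_ ?_ ?_) Ioo_subset_Ioc_self
  · exact (Real.continuous_arcsin.comp (by fun_prop)).continuousOn
  · intro s hs
    have h := (Real.hasDerivAt_arcsin (x := 2 * s - 1) (by linarith [hs.1]) (by linarith [hs.2])).comp s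
      (((hasDerivAt_id s).const_mul 2).sub_const 1)
    refine h.congr_deriv ?_
    have h4 : (1 : ℝ) - (2 * s - 1) ^ 2 = 2 ^ 2 * (s * (1 - s)) := by ring
    rw [h4, Real.sqrt_mul (by norm_num), Real.sqrt_sq (by norm_num)]
    have : √(s * (1 - s)) ≠ 0 :=
      (Real.sqrt_pos.2 (mul_pos hs.1 (by linarith [hs.2]))).ne'
    field_simp
  · intro s _
    positivity

/-- The right inverse of a strictly increasing bijection between open intervals is continuous. -/
lemma continuousAt_rightInverse_of_strictMonoOn {V φ : ℝ → ℝ} {c d u : ℝ}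
    (hV : StrictMonoOn V (Ioo 0 d)) (hVmaps : MapsTo V (Ioo 0 d) (Ioo 0 c))
    (hφ : MapsTo φ (Ioo 0 c) (Ioo 0 d)) (hVφ : ∀ v ∈ Ioo 0 c, V (φ v) = v)
    (hu : u ∈ Ioo 0 c) : ContinuousAt φ u := by
  refine StrictMonoOn.continuousAt_of_image_mem_nhds (s := Ioo 0 c) ?_
    (Ioo_mem_nhds hu.1 hu.2) ?_
  · intro v hv w hw hvw
    rw [← hV.lt_iff_lt (hφ hv) (hφ hw), hVφ v hv, hVφ w hw]
    exact hvw
  · refine mem_of_superset (Ioo_mem_nhds (hφ hu).1 (hφ hu).2) fun x hx => ?_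
    exact ⟨V x, hVmaps hx, hV.injOn (hφ (hVmaps hx)) hx (hVφ _ (hVmaps hx))⟩

section ChangeOfVariables

variable {f V V' φ : ℝ → ℝ} {E : ℝ}

lemma abs_deriv_smul_kernel (hE : 0 < E)
    (hVφ : ∀ u ∈ Ioo 0 E, V (φ u) = u) {s : ℝ} (hs : s ∈ Ioo (0 : ℝ) 1) :
    |(V' (φ (E * s)))⁻¹ * E| • (f (φ (E * s)) / √(E - V (φ (E * s)))) =
      √(E * s) * f (φ (E * s)) / |V' (φ (E * s))| * (√(s * (1 - s)))⁻¹ := by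
  have hs' : 0 < 1 - s := by linarith [hs.2]
  rw [hVφ _ ⟨mul_pos hE hs.1, by nlinarith [hs.2]⟩, abs_mul, abs_inv, abs_of_pos hE,
    show E - E * s = E * (1 - s) by ring, Real.sqrt_mul hE.le, Real.sqrt_mul hE.le,
    Real.sqrt_mul hs.1.le, smul_eq_mul]
  have h1 := Real.sqrt_pos.2 hE
  have h2 := Real.sqrt_pos.2 hs.1
  have h3 := Real.sqrt_pos.2 hs'
  have h4 := Real.mul_self_sqrt hE.le
  field_simp
  rw [sq, h4, mul_comm]

lemma hasDerivWithinAt_comp_mul_left (hE : 0 < E)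
    (hφ : ∀ u ∈ Ioo 0 E, HasDerivAt φ (V' (φ u))⁻¹ u) :
    ∀ s ∈ Ioo (0 : ℝ) 1, HasDerivWithinAt (fun s => φ (E * s)) ((V' (φ (E * s)))⁻¹ * E)
      (Ioo 0 1) s := fun s hs => by
  have h := (hφ (E * s) ⟨mul_pos hE hs.1, by nlinarith [hs.2]⟩).comp s
    ((hasDerivAt_id s).const_mul E)
  exact h.hasDerivWithinAt.congr_deriv (by simp)

lemma injOn_comp_mul_left (hE : 0 < E) (hVφ : ∀ u ∈ Ioo 0 E, V (φ u) = u) :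
    InjOn (fun s => φ (E * s)) (Ioo (0 : ℝ) 1) := fun s hs t ht hst => by
  have h := congrArg V hst
  simp only at h
  rw [hVφ _ ⟨mul_pos hE hs.1, by nlinarith [hs.2]⟩,
    hVφ _ ⟨mul_pos hE ht.1, by nlinarith [ht.2]⟩] at h
  exact mul_left_cancel₀ hE.ne' h

lemma image_comp_mul_left (hE : 0 < E) :
    (fun s => φ (E * s)) '' Ioo (0 : ℝ) 1 = φ '' Ioo 0 E := by
  rw [← image_image φ (fun s => E * s), image_mul_left_Ioo hE]
  simp

lemma integral_div_sqrt_sub_eq (hE : 0 < E)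
    (hφ : ∀ u ∈ Ioo 0 E, HasDerivAt φ (V' (φ u))⁻¹ u) (hVφ : ∀ u ∈ Ioo 0 E, V (φ u) = u) :
    ∫ x in φ '' Ioo 0 E, f x / √(E - V x) =
      ∫ s in Ioo (0 : ℝ) 1,
        √(E * s) * f (φ (E * s)) / |V' (φ (E * s))| * (√(s * (1 - s)))⁻¹ := by
  rw [← image_comp_mul_left hE, integral_image_eq_integral_abs_deriv_smul measurableSet_Ioo
    (hasDerivWithinAt_comp_mul_left hE hφ) (injOn_comp_mul_left hE hVφ)]
  exact setIntegral_congr_fun measurableSet_Ioo fun s hs => abs_deriv_smul_kernel hE hVφ hs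

lemma integrableOn_div_sqrt_sub_iff (hE : 0 < E)
    (hφ : ∀ u ∈ Ioo 0 E, HasDerivAt φ (V' (φ u))⁻¹ u) (hVφ : ∀ u ∈ Ioo 0 E, V (φ u) = u) :
    IntegrableOn (fun x => f x / √(E - V x)) (φ '' Ioo 0 E) ↔
      IntegrableOn (fun s => √(E * s) * f (φ (E * s)) / |V' (φ (E * s))| * (√(s * (1 - s)))⁻¹)
        (Ioo (0 : ℝ) 1) := by
  rw [← image_comp_mul_left hE, integrableOn_image_iff_integrableOn_abs_deriv_smul
    measurableSet_Ioo (hasDerivWithinAt_comp_mul_left hE hφ) (injOn_comp_mul_left hE hVφ)]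
  exact integrableOn_congr_fun (fun s hs => abs_deriv_smul_kernel hE hVφ hs) measurableSet_Ioo

end ChangeOfVariables

section Limits

variable {V : ℝ → ℝ}

lemma eventually_deriv_ne_zero (hV''0 : 0 < deriv (deriv V) 0) :
    ∀ᶠ x in 𝓝[≠] 0, deriv V x ≠ 0 := by
  have h : HasDerivAt (deriv V) (deriv (deriv V) 0) 0 :=
    (differentiableAt_of_deriv_ne_zero hV''0.ne').hasDerivAt
  exact h.eventually_ne hV''0.ne'

lemma tendsto_div_deriv_sq (hV : ContDiff ℝ 3 V) (hV0 : V 0 = 0) (hV'0 : deriv V 0 = 0)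
    (hV''0 : 0 < deriv (deriv V) 0) :
    Tendsto (fun x => V x / deriv V x ^ 2) (𝓝[≠] 0) (𝓝 (1 / (2 * deriv (deriv V) 0))) := by
  have hV1 : ContDiff ℝ 2 (deriv V) := (contDiff_succ_iff_deriv (n := 2)).1 hV |>.2.2
  have hV2 : ContDiff ℝ 1 (deriv (deriv V)) := (contDiff_succ_iff_deriv (n := 1)).1 hV1 |>.2.2
  have hne := eventually_deriv_ne_zero hV''0
  have hne2 : ∀ᶠ x in 𝓝[≠] (0 : ℝ), deriv (deriv V) x ≠ 0 :=
    (hV2.continuous.continuousAt.eventually_ne hV''0.ne').filter_mono nhdsWithin_le_nhds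
  refine HasDerivAt.lhopital_zero_nhdsNE (f' := deriv V)
    (g' := fun x => 2 * deriv V x * deriv (deriv V) x) ?_ ?_ ?_ ?_ ?_ ?_
  · exact Eventually.of_forall fun x => (hV.differentiable (by norm_num) x).hasDerivAt
  · refine Eventually.of_forall fun x => ?_
    exact ((hV1.differentiable (by norm_num) x).hasDerivAt.pow 2).congr_deriv (by simp)
  · filter_upwards [hne, hne2] with x h1 h2
    positivity
  · simpa [hV0] using (hV.continuous.tendsto 0).mono_left nhdsWithin_le_nhds
  · have : ContinuousAt (fun x => deriv V x ^ 2) 0 := (hV1.continuous.pow 2).continuousAt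
    simpa [ContinuousAt, hV'0] using this.tendsto.mono_left nhdsWithin_le_nhds
  · have : Tendsto (fun x => 1 / (2 * deriv (deriv V) x)) (𝓝[≠] 0)
        (𝓝 (1 / (2 * deriv (deriv V) 0))) :=
      (tendsto_const_nhds.div (tendsto_const_nhds.mul hV2.continuous.continuousAt.tendsto)
        (by positivity)).mono_left nhdsWithin_le_nhds
    refine this.congr' ?_
    filter_upwards [hne, hne2] with x h1 h2
    field_simp

lemma hasDerivAt_div_deriv_sq (hV : ContDiff ℝ 3 V) {x : ℝ} (hx : deriv V x ≠ 0) :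
    HasDerivAt (fun x => V x / deriv V x ^ 2)
      ((deriv V x ^ 2 - 2 * V x * deriv (deriv V) x) / deriv V x ^ 3) x := by
  have hV1 : ContDiff ℝ 2 (deriv V) := (contDiff_succ_iff_deriv (n := 2)).1 hV |>.2.2
  refine ((hV.differentiable (by norm_num) x).hasDerivAt.div
    ((hV1.differentiable (by norm_num) x).hasDerivAt.pow 2) (pow_ne_zero 2 hx)).congr_deriv ?_
  simp
  field_simp

lemma tendsto_deriv_div_deriv_sq (hV : ContDiff ℝ 3 V) (hV0 : V 0 = 0) (hV'0 : deriv V 0 = 0)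
    (hV''0 : 0 < deriv (deriv V) 0) :
    ∃ l, Tendsto (deriv fun x => V x / deriv V x ^ 2) (𝓝[≠] 0) (𝓝 l) := by
  have hV1 : ContDiff ℝ 2 (deriv V) := (contDiff_succ_iff_deriv (n := 2)).1 hV |>.2.2
  have hV2 : ContDiff ℝ 1 (deriv (deriv V)) := (contDiff_succ_iff_deriv (n := 1)).1 hV1 |>.2.2
  have hV3 : Continuous (deriv (deriv (deriv V))) := hV2.continuous_deriv (by norm_num)
  have hd (x) := (hV.differentiable (by norm_num) x).hasDerivAt
  have hd1 (x) := (hV1.differentiable (by norm_num) x).hasDerivAt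
  have hd2 (x) := (hV2.differentiable (by norm_num) x).hasDerivAt
  have hne := eventually_deriv_ne_zero hV''0
  have hne2 : ∀ᶠ x in 𝓝[≠] (0 : ℝ), deriv (deriv V) x ≠ 0 :=
    (hV2.continuous.continuousAt.eventually_ne hV''0.ne').filter_mono nhdsWithin_le_nhds
  have hc : Continuous fun x => deriv V x ^ 2 - 2 * V x * deriv (deriv V) x :=
    (hV1.continuous.pow 2).sub ((continuous_const.mul hV.continuous).mul hV2.continuous)
  refine ⟨_, (HasDerivAt.lhopital_zero_nhdsNE
    (l := 𝓝 (-2 / 3 * (1 / (2 * deriv (deriv V) 0)) *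
      (deriv (deriv (deriv V)) 0 / deriv (deriv V) 0)))
    (f := fun x => deriv V x ^ 2 - 2 * V x * deriv (deriv V) x)
    (g := fun x => deriv V x ^ 3)
    (f' := fun x => -2 * V x * deriv (deriv (deriv V)) x)
    (g' := fun x => 3 * deriv V x ^ 2 * deriv (deriv V) x) ?_ ?_ ?_ ?_ ?_ ?_).congr' ?_⟩
  · refine Eventually.of_forall fun x => ?_
    refine (((hd1 x).pow 2).sub (((hd x).const_mul 2).mul (hd2 x))).congr_deriv ?_
    simp
  · refine Eventually.of_forall fun x => ?_
    exact ((hd1 x).pow 3).congr_deriv (by simp)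
  · filter_upwards [hne, hne2] with x h1 h2
    positivity
  · simpa [hV0, hV'0] using (hc.tendsto 0).mono_left nhdsWithin_le_nhds
  · have : ContinuousAt (fun x => deriv V x ^ 3) 0 := (hV1.continuous.pow 3).continuousAt
    simpa [ContinuousAt, hV'0] using this.tendsto.mono_left nhdsWithin_le_nhds
  · have h3 : Tendsto (fun x => deriv (deriv (deriv V)) x / deriv (deriv V) x) (𝓝[≠] 0)
        (𝓝 (deriv (deriv (deriv V)) 0 / deriv (deriv V) 0)) :=
      (hV3.continuousAt.tendsto.div hV2.continuous.continuousAt.tendsto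
        hV''0.ne').mono_left nhdsWithin_le_nhds
    refine ((tendsto_const_nhds.mul (tendsto_div_deriv_sq hV hV0 hV'0 hV''0)).mul h3).congr' ?_
    filter_upwards [hne, hne2] with x h1 h2
    field_simp
  · filter_upwards [hne] with x h1
    exact (hasDerivAt_div_deriv_sq hV h1).deriv.symm

end Limits

lemma le_of_antitoneOn_of_tendsto {M : ℝ → ℝ} {a b l x y : ℝ} (h₁ : AntitoneOn M (Ioo a 0))
    (h₂ : AntitoneOn M (Ioo 0 b)) (hl : Tendsto M (𝓝[≠] 0) (𝓝 l)) (hx : x ∈ Ioo a 0)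
    (hy : y ∈ Ioo 0 b) : M y ≤ M x := by
  trans l
  · refine ge_of_tendsto (hl.mono_left (nhdsWithin_mono 0 fun z hz => ne_of_gt hz) :
      Tendsto M (𝓝[>] 0) (𝓝 l)) ?_
    filter_upwards [Ioo_mem_nhdsGT hy.1] with z hz
    exact h₂ ⟨hz.1, hz.2.trans hy.2⟩ hy hz.2.le
  · refine le_of_tendsto (hl.mono_left (nhdsWithin_mono 0 fun z hz => ne_of_lt hz) :
      Tendsto M (𝓝[<] 0) (𝓝 l)) ?_
    filter_upwards [Ioo_mem_nhdsLT hx.2] with z hz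
    exact h₁ hx ⟨hx.1.trans hz.1, hz.2⟩ hz.1.le

section Weight

variable {V φ μ : ℝ → ℝ}

/-- A primitive of `NFun` on each side of the equilibrium. -/
noncomputable def nPrimitive (μ V : ℝ → ℝ) (x : ℝ) : ℝ :=
  deriv (fun y => (V y / (deriv V y) ^ 2) * √(μ y)) x
    + (V x / (deriv V x) ^ 2) * deriv (fun z => √(μ z)) x

/-- The density of the half-period in the variable `V x`, multiplied by `√(V x)`. -/
noncomputable def periodWeight (μ V : ℝ → ℝ) (x : ℝ) : ℝ :=
  √(V x) * √(μ x) / deriv V x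

lemma differentiableAt_nPrimitive (hμ : ContDiff ℝ 3 μ) (hV : ContDiff ℝ 3 V) {x : ℝ}
    (hx : deriv V x ≠ 0) (hμx : 0 < μ x) :
    DifferentiableAt ℝ (nPrimitive μ V) x ∧ deriv (nPrimitive μ V) x = NFun μ V x := by
  have hV1 : ContDiff ℝ 2 (deriv V) := (contDiff_succ_iff_deriv (n := 2)).1 hV |>.2.2
  set U : Set ℝ := {x | deriv V x ≠ 0} ∩ {x | 0 < μ x}
  have hU : IsOpen U :=
    (isOpen_ne_fun hV1.continuous continuous_const).inter
      (isOpen_lt continuous_const hμ.continuous)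
  have hxU : x ∈ U := ⟨hx, hμx⟩
  have hh : ContDiffOn ℝ 2 (fun y => V y / deriv V y ^ 2) U :=
    (hV.of_le (by norm_num)).contDiffOn.div (hV1.pow 2).contDiffOn
      fun y hy => pow_ne_zero 2 hy.1
  have hf : ContDiffOn ℝ 3 (fun y => √(μ y)) U := hμ.contDiffOn.sqrt fun y hy => hy.2.ne'
  have h1 : DifferentiableAt ℝ (deriv fun y => (V y / (deriv V y) ^ 2) * √(μ y)) x :=
    (((hh.mul (hf.of_le (by norm_num))).deriv_of_isOpen (m := 1) hU
      (by norm_num)).differentiableOn (by norm_num)).differentiableAt (hU.mem_nhds hxU)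
  have h2 : DifferentiableAt ℝ
      (fun y => (V y / (deriv V y) ^ 2) * deriv (fun z => √(μ z)) y) x :=
    ((hh.mul (hf.deriv_of_isOpen (m := 2) hU (by norm_num))).differentiableOn
      (by norm_num)).differentiableAt (hU.mem_nhds hxU)
  exact ⟨h1.add h2, deriv_add h1 h2⟩

lemma differentiableAt_sqrt_comp (hμ : ContDiff ℝ 3 μ) {x : ℝ} (hμx : 0 < μ x) :
    DifferentiableAt ℝ (fun z => √(μ z)) x :=
  (hμ.differentiable (by norm_num) x).sqrt hμx.ne'

lemma nPrimitive_eq (hμ : ContDiff ℝ 3 μ) (hV : ContDiff ℝ 3 V) {x : ℝ}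
    (hx : deriv V x ≠ 0) (hμx : 0 < μ x) :
    nPrimitive μ V x = deriv (fun y => V y / deriv V y ^ 2) x * √(μ x) +
      2 * (V x / deriv V x ^ 2) * deriv (fun z => √(μ z)) x := by
  rw [nPrimitive, ((hasDerivAt_div_deriv_sq hV hx).differentiableAt.hasDerivAt.fun_mul
    (differentiableAt_sqrt_comp hμ hμx).hasDerivAt).deriv]
  ring

lemma tendsto_nPrimitive (hμ : ContDiff ℝ 3 μ) (hV : ContDiff ℝ 3 V) (hV0 : V 0 = 0)
    (hV'0 : deriv V 0 = 0) (hV''0 : 0 < deriv (deriv V) 0) (hμ0 : 0 < μ 0) :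
    ∃ l, Tendsto (nPrimitive μ V) (𝓝[≠] 0) (𝓝 l) := by
  obtain ⟨l, hl⟩ := tendsto_deriv_div_deriv_sq hV hV0 hV'0 hV''0
  have hf : Tendsto (fun x => √(μ x)) (𝓝[≠] 0) (𝓝 √(μ 0)) :=
    (hμ.continuous.sqrt.tendsto 0).mono_left nhdsWithin_le_nhds
  have hopen : IsOpen {x | 0 < μ x} := isOpen_lt continuous_const hμ.continuous
  have hf' : Tendsto (deriv fun x => √(μ x)) (𝓝[≠] 0) (𝓝 (deriv (fun x => √(μ x)) 0)) := by
    have h : ContDiffOn ℝ 3 (fun y => √(μ y)) {x | 0 < μ x} :=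
      hμ.contDiffOn.sqrt fun y hy => ne_of_gt hy
    exact ((h.continuousOn_deriv_of_isOpen hopen (by norm_num)).continuousAt
      (hopen.mem_nhds hμ0)).tendsto.mono_left nhdsWithin_le_nhds
  refine ⟨_, ((hl.mul hf).add (((tendsto_div_deriv_sq hV hV0 hV'0 hV''0).const_mul 2).mul
    hf')).congr' ?_⟩
  filter_upwards [eventually_deriv_ne_zero hV''0,
    nhdsWithin_le_nhds (hopen.mem_nhds hμ0)] with x h1 h2
  exact (nPrimitive_eq hμ hV h1 h2).symm

lemma hasDerivAt_periodWeight (hμ : ContDiff ℝ 3 μ) (hV : ContDiff ℝ 3 V) {x : ℝ}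
    (hVx : 0 < V x) (hx : deriv V x ≠ 0) (hμx : 0 < μ x) :
    HasDerivAt (periodWeight μ V) (deriv V x * (nPrimitive μ V x / (2 * √(V x)))) x := by
  have hV1 : ContDiff ℝ 2 (deriv V) := (contDiff_succ_iff_deriv (n := 2)).1 hV |>.2.2
  rw [nPrimitive_eq hμ hV hx hμx, (hasDerivAt_div_deriv_sq hV hx).deriv]
  refine ((((hV.differentiable (by norm_num) x).hasDerivAt.sqrt hVx.ne').mul
    (differentiableAt_sqrt_comp hμ hμx).hasDerivAt).div
    (hV1.differentiable (by norm_num) x).hasDerivAt hx).congr_deriv ?_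
  have h1 := Real.sqrt_pos.2 hVx
  have h2 := Real.sq_sqrt hVx.le
  simp only [Pi.mul_apply]
  field_simp
  rw [h2]
  ring

lemma hasDerivAt_periodWeight_comp (hμ : ContDiff ℝ 3 μ) (hV : ContDiff ℝ 3 V) {u : ℝ}
    (hu : 0 < u) (hVu : V (φ u) = u) (hx : deriv V (φ u) ≠ 0) (hμx : 0 < μ (φ u))
    (hφ : HasDerivAt φ (deriv V (φ u))⁻¹ u) :
    HasDerivAt (fun u => periodWeight μ V (φ u)) (nPrimitive μ V (φ u) / (2 * √u)) u := by
  refine ((hasDerivAt_periodWeight hμ hV (hVu.symm ▸ hu) hx hμx).comp u hφ).congr_deriv ?_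
  rw [hVu]
  field_simp

/-- The weight is bounded on compact intervals, including near the equilibrium. -/
lemma exists_abs_periodWeight_le (hμ : ContDiff ℝ 3 μ) (hV : ContDiff ℝ 3 V) (hV0 : V 0 = 0)
    (hV'0 : deriv V 0 = 0) (hV''0 : 0 < deriv (deriv V) 0) {c d : ℝ}
    (hVpos : ∀ x ∈ Icc c d, 0 ≤ V x) (hμpos : ∀ x ∈ Icc c d, 0 ≤ μ x)
    (hne : ∀ x ∈ Icc c d, x ≠ 0 → deriv V x ≠ 0) :
    ∃ C, ∀ x ∈ Icc c d, |periodWeight μ V x| ≤ C := by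
  have hV1 : ContDiff ℝ 2 (deriv V) := (contDiff_succ_iff_deriv (n := 2)).1 hV |>.2.2
  have hc : ContinuousOn (Function.update (fun x => V x / deriv V x ^ 2) 0
      (1 / (2 * deriv (deriv V) 0))) (Icc c d) := by
    intro x hx
    rcases eq_or_ne x 0 with rfl | hx0
    · exact (continuousAt_update_same.2
        (tendsto_div_deriv_sq hV hV0 hV'0 hV''0)).continuousWithinAt
    · exact ((continuousAt_update_of_ne hx0).2
        (hasDerivAt_div_deriv_sq hV (hne x hx hx0)).continuousAt).continuousWithinAt
  obtain ⟨C, hC⟩ := isCompact_Icc.exists_bound_of_continuousOn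
    (hc.mul hμ.continuous.continuousOn)
  refine ⟨√C, fun x hx => ?_⟩
  apply Real.abs_le_sqrt
  rcases eq_or_ne x 0 with rfl | hx0
  · simpa [periodWeight, hV'0] using (norm_nonneg _).trans (hC _ hx)
  · have h := (le_abs_self _).trans (hC x hx)
    simp only [Pi.mul_apply, Function.update_of_ne hx0] at h
    rw [periodWeight, div_pow, mul_pow, Real.sq_sqrt (hVpos x hx), Real.sq_sqrt (hμpos x hx)]
    rwa [mul_div_right_comm]

end Weight

/-- Integrability and substitution `x = φ (E * s)` for one half of the period integral. -/
lemma halfPeriod_integrals {μ V φ : ℝ → ℝ} {E : ℝ} (hE : 0 < E)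
    (hφ : ∀ u ∈ Ioo 0 E, HasDerivAt φ (deriv V (φ u))⁻¹ u)
    (hVφ : ∀ u ∈ Ioo 0 E, V (φ u) = u)
    (hcont : ContinuousOn (fun u => periodWeight μ V (φ u)) (Ioo 0 E))
    (hbdd : ∃ C, ∀ u ∈ Ioo 0 E, |periodWeight μ V (φ u)| ≤ C) :
    IntegrableOn (fun s => |periodWeight μ V (φ (E * s))| * (√(s * (1 - s)))⁻¹)
        (Ioo (0 : ℝ) 1) ∧
      IntegrableOn (fun x => √(μ x) / √(E - V x)) (φ '' Ioo 0 E) ∧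
      ∫ x in φ '' Ioo 0 E, √(μ x) / √(E - V x) =
        ∫ s in Ioo (0 : ℝ) 1, |periodWeight μ V (φ (E * s))| * (√(s * (1 - s)))⁻¹ := by
  have hmaps : MapsTo (fun s => E * s) (Ioo (0 : ℝ) 1) (Ioo 0 E) := fun s hs =>
    ⟨mul_pos hE hs.1, by nlinarith [hs.2]⟩
  have hweight : EqOn
      (fun s => √(E * s) * √(μ (φ (E * s))) / |deriv V (φ (E * s))| * (√(s * (1 - s)))⁻¹)
      (fun s => |periodWeight μ V (φ (E * s))| * (√(s * (1 - s)))⁻¹) (Ioo (0 : ℝ) 1) := by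
    intro s hs
    simp only
    rw [periodWeight, hVφ _ (hmaps hs), abs_div,
      abs_of_nonneg (mul_nonneg (Real.sqrt_nonneg (E * s)) (Real.sqrt_nonneg _))]
  have hint : IntegrableOn (fun s => |periodWeight μ V (φ (E * s))| * (√(s * (1 - s)))⁻¹)
      (Ioo (0 : ℝ) 1) := by
    obtain ⟨C, hC⟩ := hbdd
    refine Integrable.bdd_mul (c := C) integrableOn_inv_sqrt_mul_one_sub
      ((hcont.comp (by fun_prop) hmaps).abs.aestronglyMeasurable measurableSet_Ioo) ?_
    filter_upwards [ae_restrict_mem measurableSet_Ioo] with s hs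
    simpa using hC _ (hmaps hs)
  refine ⟨hint, ?_, ?_⟩
  · exact (integrableOn_div_sqrt_sub_iff (f := fun x => √(μ x)) hE hφ hVφ).2
      ((integrableOn_congr_fun hweight measurableSet_Ioo).2 hint)
  · exact (integral_div_sqrt_sub_eq (f := fun x => √(μ x)) hE hφ hVφ).trans
      (setIntegral_congr_fun measurableSet_Ioo hweight)

end PeriodMonotone

open Set MeasureTheory PeriodMonotone in
/-- If `N ≤ 0` on `K(E*) \ {0}` then the period function is monotonically
non-increasing on `(0, E*)`. -/
theorem period_monotone_nonincreasing
    (μ V : ℝ → ℝ) (Estar a b : ℝ)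
    (hμ : ContDiff ℝ 3 μ) (hV : ContDiff ℝ 3 V)
    (ha : a < 0) (hb : 0 < b)
    (hK : {x : ℝ | V x ≤ Estar} = Set.Icc a b)
    (hμpos : ∀ x ∈ Set.Icc a b, 0 < μ x)
    (hV0 : V 0 = 0) (hV'0 : deriv V 0 = 0) (hV''0 : 0 < deriv (deriv V) 0)
    (hV'neg : ∀ x ∈ Set.Ioo a 0, deriv V x < 0)
    (hV'pos : ∀ x ∈ Set.Ioo 0 b, 0 < deriv V x)
    (xm xp : ℝ → ℝ)
    (hxm : ∀ E ∈ Set.Ioo 0 Estar, xm E ∈ Set.Ioo a 0 ∧ V (xm E) = E)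
    (hxp : ∀ E ∈ Set.Ioo 0 Estar, xp E ∈ Set.Ioo 0 b ∧ V (xp E) = E)
    (T : ℝ → ℝ)
    (hT : ∀ E ∈ Set.Ioo 0 Estar,
      T E = Real.sqrt 2 * ∫ x in xm E..xp E, Real.sqrt (μ x) / Real.sqrt (E - V x))
    (hN : ∀ x ∈ Set.Icc a b, x ≠ 0 → NFun μ V x ≤ 0) :
    ∀ E₁ ∈ Set.Ioo 0 Estar, ∀ E₂ ∈ Set.Ioo 0 Estar, E₁ ≤ E₂ → T E₂ ≤ T E₁ := by
  have hV1 : ContDiff ℝ 2 (deriv V) := (contDiff_succ_iff_deriv (n := 2)).1 hV |>.2.2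
  have hVd (x : ℝ) : HasDerivAt V (deriv V x) x := (hV.differentiable (by norm_num) x).hasDerivAt
  have hVb : V b ≤ Estar :=
    (hK.symm ▸ right_mem_Icc.2 (ha.trans hb).le : b ∈ {x : ℝ | V x ≤ Estar})
  have hVa : V a ≤ Estar :=
    (hK.symm ▸ left_mem_Icc.2 (ha.trans hb).le : a ∈ {x : ℝ | V x ≤ Estar})
  have hmono : StrictMonoOn V (Icc 0 b) :=
    strictMonoOn_of_deriv_pos (convex_Icc 0 b) hV.continuous.continuousOn
      (by rwa [interior_Icc])
  have hanti : StrictAntiOn V (Icc a 0) :=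
    strictAntiOn_of_deriv_neg (convex_Icc a 0) hV.continuous.continuousOn
      (by rwa [interior_Icc])
  have hmapsP : MapsTo V (Ioo 0 b) (Ioo 0 Estar) := fun x hx =>
    ⟨by simpa [hV0] using hmono (left_mem_Icc.2 hb.le) (Ioo_subset_Icc_self hx) hx.1,
      (hmono (Ioo_subset_Icc_self hx) (right_mem_Icc.2 hb.le) hx.2).trans_le hVb⟩
  have hmapsM : MapsTo V (Ioo a 0) (Ioo 0 Estar) := fun x hx =>
    ⟨by simpa [hV0] using hanti (Ioo_subset_Icc_self hx) (right_mem_Icc.2 ha.le) hx.2,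
      (hanti (left_mem_Icc.2 ha.le) (Ioo_subset_Icc_self hx) hx.1).trans_le hVa⟩
  have hcP : ∀ u ∈ Ioo 0 Estar, ContinuousAt xp u := fun u hu =>
    continuousAt_rightInverse_of_strictMonoOn (hmono.mono Ioo_subset_Icc_self) hmapsP
      (fun v hv => (hxp v hv).1) (fun v hv => (hxp v hv).2) hu
  have hcM : ∀ u ∈ Ioo 0 Estar, ContinuousAt xm u := fun u hu => by
    have hneg : MapsTo (fun x : ℝ => -x) (Ioo 0 (-a)) (Ioo a 0) := fun x hx =>
      ⟨by linarith [hx.2], by linarith [hx.1]⟩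
    have h := continuousAt_rightInverse_of_strictMonoOn (V := fun x => V (-x))
      (φ := fun u => -xm u) (c := Estar) (d := -a)
      (fun x hx y hy hxy => hanti (Ioo_subset_Icc_self (hneg hy)) (Ioo_subset_Icc_self (hneg hx))
        (neg_lt_neg hxy))
      (hmapsM.comp hneg)
      (fun v hv => ⟨neg_pos.2 (hxm v hv).1.2, neg_lt_neg (hxm v hv).1.1⟩)
      (fun v hv => by simpa using (hxm v hv).2) hu
    exact h.neg.congr (Filter.Eventually.of_forall fun v => neg_neg (xm v))
  have hdP : ∀ u ∈ Ioo 0 Estar, HasDerivAt xp (deriv V (xp u))⁻¹ u := fun u hu =>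
    HasDerivAt.of_local_left_inverse (hcP u hu) (hVd _) (hV'pos _ (hxp u hu).1).ne'
      (by filter_upwards [Ioo_mem_nhds hu.1 hu.2] with v hv using (hxp v hv).2)
  have hdM : ∀ u ∈ Ioo 0 Estar, HasDerivAt xm (deriv V (xm u))⁻¹ u := fun u hu =>
    HasDerivAt.of_local_left_inverse (hcM u hu) (hVd _) (hV'neg _ (hxm u hu).1).ne
      (by filter_upwards [Ioo_mem_nhds hu.1 hu.2] with v hv using (hxm v hv).2)
  have hIP : Ioo 0 b ⊆ Icc a b := fun x hx => ⟨ha.le.trans hx.1.le, hx.2.le⟩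
  have hIM : Ioo a 0 ⊆ Icc a b := fun x hx => ⟨hx.1.le, hx.2.le.trans hb.le⟩
  -- `nPrimitive` decreases across the whole well.
  have hNP : AntitoneOn (nPrimitive μ V) (Ioo 0 b) := by
    have hd (x) (hx : x ∈ Ioo 0 b) :=
      differentiableAt_nPrimitive hμ hV (hV'pos x hx).ne' (hμpos x (hIP hx))
    refine antitoneOn_of_deriv_nonpos (convex_Ioo 0 b)
      (fun x hx => (hd x hx).1.continuousAt.continuousWithinAt) ?_ ?_ <;> rw [interior_Ioo]
    · exact fun x hx => (hd x hx).1.differentiableWithinAt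
    · exact fun x hx => (hd x hx).2 ▸ hN x (hIP hx) hx.1.ne'
  have hNM : AntitoneOn (nPrimitive μ V) (Ioo a 0) := by
    have hd (x) (hx : x ∈ Ioo a 0) :=
      differentiableAt_nPrimitive hμ hV (hV'neg x hx).ne (hμpos x (hIM hx))
    refine antitoneOn_of_deriv_nonpos (convex_Ioo a 0)
      (fun x hx => (hd x hx).1.continuousAt.continuousWithinAt) ?_ ?_ <;> rw [interior_Ioo]
    · exact fun x hx => (hd x hx).1.differentiableWithinAt
    · exact fun x hx => (hd x hx).2 ▸ hN x (hIM hx) hx.2.ne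
  obtain ⟨l, hl⟩ := tendsto_nPrimitive hμ hV hV0 hV'0 hV''0 (hμpos 0 ⟨ha.le, hb.le⟩)
  -- The symmetrized weight decreases with the energy.
  have hwP : ∀ u ∈ Ioo 0 Estar, HasDerivAt (fun u => periodWeight μ V (xp u))
      (nPrimitive μ V (xp u) / (2 * √u)) u := fun u hu =>
    hasDerivAt_periodWeight_comp hμ hV hu.1 (hxp u hu).2 (hV'pos _ (hxp u hu).1).ne'
      (hμpos _ (hIP (hxp u hu).1)) (hdP u hu)
  have hwM : ∀ u ∈ Ioo 0 Estar, HasDerivAt (fun u => periodWeight μ V (xm u))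
      (nPrimitive μ V (xm u) / (2 * √u)) u := fun u hu =>
    hasDerivAt_periodWeight_comp hμ hV hu.1 (hxm u hu).2 (hV'neg _ (hxm u hu).1).ne
      (hμpos _ (hIM (hxm u hu).1)) (hdM u hu)
  have hW : AntitoneOn (fun u => periodWeight μ V (xp u) - periodWeight μ V (xm u))
      (Ioo 0 Estar) := by
    have hd (u) (hu : u ∈ Ioo 0 Estar) := (hwP u hu).fun_sub (hwM u hu)
    refine antitoneOn_of_deriv_nonpos (convex_Ioo 0 Estar)
      (fun u hu => (hd u hu).continuousAt.continuousWithinAt) ?_ ?_ <;> rw [interior_Ioo]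
    · exact fun u hu => (hd u hu).differentiableAt.differentiableWithinAt
    · intro u hu
      rw [(hd u hu).deriv, ← sub_div]
      exact div_nonpos_of_nonpos_of_nonneg (sub_nonpos.2
        (le_of_antitoneOn_of_tendsto hNM hNP hl (hxm u hu).1 (hxp u hu).1)) (by positivity)
  have himP : ∀ E ∈ Ioo 0 Estar, xp '' Ioo 0 E = Ioo 0 (xp E) := fun E hE => by
    have hlt (x) (hx : x ∈ Ioo 0 b) : x < xp E ↔ V x < E := by
      conv_rhs => rw [← (hxp E hE).2]
      exact (hmono.lt_iff_lt (Ioo_subset_Icc_self hx)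
        (Ioo_subset_Icc_self (hxp E hE).1)).symm
    ext x
    constructor
    · rintro ⟨u, hu, rfl⟩
      have h := hxp u ⟨hu.1, hu.2.trans hE.2⟩
      exact ⟨h.1.1, (hlt _ h.1).2 (h.2.symm ▸ hu.2)⟩
    · intro hx
      have hxb : x ∈ Ioo 0 b := ⟨hx.1, hx.2.trans (hxp E hE).1.2⟩
      have h := hxp _ (hmapsP hxb)
      exact ⟨V x, ⟨(hmapsP hxb).1, (hlt x hxb).1 hx.2⟩,
        hmono.injOn (Ioo_subset_Icc_self h.1) (Ioo_subset_Icc_self hxb) h.2⟩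
  have himM : ∀ E ∈ Ioo 0 Estar, xm '' Ioo 0 E = Ioo (xm E) 0 := fun E hE => by
    have hlt (x) (hx : x ∈ Ioo a 0) : xm E < x ↔ V x < E := by
      conv_rhs => rw [← (hxm E hE).2]
      exact (hanti.lt_iff_gt (Ioo_subset_Icc_self hx)
        (Ioo_subset_Icc_self (hxm E hE).1)).symm
    ext x
    constructor
    · rintro ⟨u, hu, rfl⟩
      have h := hxm u ⟨hu.1, hu.2.trans hE.2⟩
      exact ⟨(hlt _ h.1).2 (h.2.symm ▸ hu.2), h.1.2⟩
    · intro hx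
      have hxa : x ∈ Ioo a 0 := ⟨(hxm E hE).1.1.trans hx.1, hx.2⟩
      have h := hxm _ (hmapsM hxa)
      exact ⟨V x, ⟨(hmapsM hxa).1, (hlt x hxa).1 hx.1⟩,
        hanti.injOn (Ioo_subset_Icc_self h.1) (Ioo_subset_Icc_self hxa) h.2⟩
  have hperiod : ∀ E ∈ Ioo 0 Estar,
      IntegrableOn (fun s => (periodWeight μ V (xp (E * s)) - periodWeight μ V (xm (E * s))) *
        (√(s * (1 - s)))⁻¹) (Ioo (0 : ℝ) 1) ∧
      T E = √2 * ∫ s in Ioo (0 : ℝ) 1,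
        (periodWeight μ V (xp (E * s)) - periodWeight μ V (xm (E * s))) *
          (√(s * (1 - s)))⁻¹ := by
    intro E hE
    have hsub : Ioo 0 E ⊆ Ioo 0 Estar := Ioo_subset_Ioo_right hE.2.le
    have hxpE := (hxp E hE).1
    have hxmE := (hxm E hE).1
    have hmem (x) (hx : x ∈ Icc (xm E) (xp E)) : x = 0 ∨ x ∈ Ioo a 0 ∨ x ∈ Ioo 0 b := by
      rcases lt_trichotomy x 0 with h | h | h
      · exact Or.inr (Or.inl ⟨hxmE.1.trans_le hx.1, h⟩)
      · exact Or.inl h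
      · exact Or.inr (Or.inr ⟨h, hx.2.trans_lt hxpE.2⟩)
    obtain ⟨C, hC⟩ := exists_abs_periodWeight_le hμ hV hV0 hV'0 hV''0
      (c := xm E) (d := xp E)
      (fun x hx => by
        rcases hmem x hx with rfl | h | h
        exacts [hV0.ge, (hmapsM h).1.le, (hmapsP h).1.le])
      (fun x hx => (hμpos x ⟨hxmE.1.le.trans hx.1, hx.2.trans hxpE.2.le⟩).le)
      (fun x hx hx0 => by
        rcases hmem x hx with h | h | h
        exacts [absurd h hx0, (hV'neg x h).ne, (hV'pos x h).ne'])
    obtain ⟨hP1, hP2, hP3⟩ := halfPeriod_integrals (μ := μ) hE.1 (fun u hu => hdP u (hsub hu))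
      (fun u hu => (hxp u (hsub hu)).2)
      (fun u hu => (hwP u (hsub hu)).continuousAt.continuousWithinAt)
      ⟨C, fun u hu => hC _ (by
        have h : xp u ∈ Ioo 0 (xp E) := himP E hE ▸ mem_image_of_mem xp hu
        exact ⟨hxmE.2.le.trans h.1.le, h.2.le⟩)⟩
    obtain ⟨hM1, hM2, hM3⟩ := halfPeriod_integrals (μ := μ) hE.1 (fun u hu => hdM u (hsub hu))
      (fun u hu => (hxm u (hsub hu)).2)
      (fun u hu => (hwM u (hsub hu)).continuousAt.continuousWithinAt)
      ⟨C, fun u hu => hC _ (by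
        have h : xm u ∈ Ioo (xm E) 0 := himM E hE ▸ mem_image_of_mem xm hu
        exact ⟨h.1.le, h.2.le.trans hxpE.1.le⟩)⟩
    rw [himP E hE] at hP2 hP3
    rw [himM E hE] at hM2 hM3
    have heq : EqOn (fun s => |periodWeight μ V (xm (E * s))| * (√(s * (1 - s)))⁻¹ +
        |periodWeight μ V (xp (E * s))| * (√(s * (1 - s)))⁻¹)
        (fun s => (periodWeight μ V (xp (E * s)) - periodWeight μ V (xm (E * s))) *
          (√(s * (1 - s)))⁻¹) (Ioo (0 : ℝ) 1) := by
      intro s hs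
      have hEs : E * s ∈ Ioo 0 Estar :=
        hsub ⟨mul_pos hE.1 hs.1, by nlinarith [hs.2, hE.1]⟩
      have h1 : 0 ≤ periodWeight μ V (xp (E * s)) :=
        div_nonneg (by positivity) (hV'pos _ (hxp _ hEs).1).le
      have h2 : periodWeight μ V (xm (E * s)) ≤ 0 :=
        div_nonpos_of_nonneg_of_nonpos (by positivity) (hV'neg _ (hxm _ hEs).1).le
      simp only [abs_of_nonneg h1, abs_of_nonpos h2]
      ring
    refine ⟨(integrableOn_congr_fun heq measurableSet_Ioo).1 (hM1.add hP1), ?_⟩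
    rw [← setIntegral_congr_fun measurableSet_Ioo heq, integral_add hM1 hP1, ← hM3, ← hP3,
      hT E hE, ← intervalIntegral.integral_add_adjacent_intervals
        ((intervalIntegrable_iff_integrableOn_Ioo_of_le hxmE.2.le).2 hM2)
        ((intervalIntegrable_iff_integrableOn_Ioo_of_le hxpE.1.le).2 hP2),
      intervalIntegral.integral_of_le hxmE.2.le, intervalIntegral.integral_of_le hxpE.1.le,
      integral_Ioc_eq_integral_Ioo, integral_Ioc_eq_integral_Ioo]
  intro E₁ h₁ E₂ h₂ h₁₂
  rw [(hperiod E₁ h₁).2, (hperiod E₂ h₂).2]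
  refine mul_le_mul_of_nonneg_left (setIntegral_mono_on (hperiod E₂ h₂).1 (hperiod E₁ h₁).1
    measurableSet_Ioo fun s hs => mul_le_mul_of_nonneg_right ?_ (by positivity)) (by positivity)
  exact hW ⟨mul_pos h₁.1 hs.1, by nlinarith [hs.1, hs.2, h₁.1, h₁.2]⟩
    ⟨mul_pos h₂.1 hs.1, by nlinarith [hs.1, hs.2, h₂.1, h₂.2]⟩
    (mul_le_mul_of_nonneg_right h₁₂ hs.1.le)
end

section
/- Let μ, V : ℝ → ℝ be C³ on an open set where μ > 0, V > 0 and V' > 0. Put h = √V and define S = (h''·μ − (1/2)·μ'·h') / (h'³ · √μ). Then S'(x) = −2·N(x) on that set, where N = ((V/V'²)·√μ)'' + ((V/V'²)·(√μ)')'. Equivalently, the function G = −S'/h' appearing in the derivative of the period function satisfies G = (2/h')·N. -/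
/-- `h = √V`. -/
noncomputable def hFun (V : ℝ → ℝ) : ℝ → ℝ := fun x => Real.sqrt (V x)

/-- `S = (h''μ − ½μ'h')/(h'³√μ)`. -/
noncomputable def SFun (μ V : ℝ → ℝ) : ℝ → ℝ := fun x =>
  (deriv (deriv (hFun V)) x * μ x - (1 / 2) * deriv μ x * deriv (hFun V) x)
    / ((deriv (hFun V) x) ^ 3 * Real.sqrt (μ x))

/-- The derivative of a function in terms of the derivative of its square root. -/
theorem deriv_eq_two_mul_sqrt_mul_deriv_sqrt {f : ℝ → ℝ} {x : ℝ}
    (hf : DifferentiableAt ℝ f x) (hx : 0 < f x) :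
    deriv f x = 2 * √(f x) * deriv (fun y => √(f y)) x := by
  rw [deriv_sqrt hf hx.ne']
  have := Real.sqrt_pos.2 hx
  field_simp

/-- `V/V'² = 1/(4h'²)` for `h = √V`. -/
theorem div_deriv_sq_eq {V : ℝ → ℝ} {x : ℝ} (hV : DifferentiableAt ℝ V x) (hx : 0 < V x) :
    V x / (deriv V x) ^ 2 = (1 / 4) * ((deriv (hFun V) x) ^ 2)⁻¹ := by
  have h0 := Real.sqrt_pos.2 hx
  have e : deriv V x = 2 * √(V x) * deriv (hFun V) x :=
    deriv_eq_two_mul_sqrt_mul_deriv_sqrt hV hx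
  rw [e, mul_pow, mul_pow, Real.sq_sqrt hx.le]
  field_simp
  norm_num

/-- `S = -2((qm)' + qm')` for `q = V/V'²` and `m = √μ`. -/
theorem SFun_eq_neg_two_mul {μ V : ℝ → ℝ} {s : Set ℝ} (hs : IsOpen s)
    (hμ : DifferentiableOn ℝ μ s) (hV : ContDiffOn ℝ 2 V s)
    (hμpos : ∀ x ∈ s, 0 < μ x) (hVpos : ∀ x ∈ s, 0 < V x)
    (hV' : ∀ x ∈ s, 0 < deriv V x) {x : ℝ} (hx : x ∈ s) :
    SFun μ V x = -2 * (deriv (fun y => (V y / (deriv V y) ^ 2) * √(μ y)) x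
      + (V x / (deriv V x) ^ 2) * deriv (fun z => √(μ z)) x) := by
  have hxs := hs.mem_nhds hx
  have hVd : ∀ y ∈ s, DifferentiableAt ℝ V y := fun y hy =>
    (hV.differentiableOn (by norm_num)).differentiableAt (hs.mem_nhds hy)
  have hμd := hμ.differentiableAt hxs
  have hh : ContDiffOn ℝ 2 (hFun V) s := hV.sqrt fun y hy => (hVpos y hy).ne'
  have hh' : HasDerivAt (deriv (hFun V)) (deriv (deriv (hFun V)) x) x :=
    (((hh.deriv_of_isOpen (m := 1) hs (by norm_num)).differentiableOn
      (by norm_num)).differentiableAt hxs).hasDerivAt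
  have hm := (hμd.sqrt (hμpos x hx).ne').hasDerivAt
  have hm0 := Real.sqrt_pos.2 (hμpos x hx)
  have hne : deriv (hFun V) x ≠ 0 := fun h0 => by
    have e : deriv V x = 2 * √(V x) * deriv (hFun V) x :=
      deriv_eq_two_mul_sqrt_mul_deriv_sqrt (hVd x hx) (hVpos x hx)
    rw [h0, mul_zero] at e
    exact (hV' x hx).ne' e
  have hq := (((hh'.fun_pow 2).fun_inv (pow_ne_zero 2 hne)).const_mul (1 / 4)).congr_of_eventuallyEq
    (Filter.eventually_of_mem hxs fun y hy => div_deriv_sq_eq (hVd y hy) (hVpos y hy))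
  rw [(hq.fun_mul hm).deriv, div_deriv_sq_eq (hVd x hx) (hVpos x hx), SFun,
    deriv_eq_two_mul_sqrt_mul_deriv_sqrt hμd (hμpos x hx)]
  nth_rewrite 1 [← Real.sq_sqrt (hμpos x hx).le]
  field_simp
  ring

/-- With `h = √V` and `S = (h''μ − ½μ'h')/(h'³√μ)` one has `S' = −2N`;
equivalently `G := −S'/h'` satisfies `G = (2/h')·N`. -/
theorem S_deriv_eq_neg_two_N
    (μ V : ℝ → ℝ) (s : Set ℝ) (hs : IsOpen s)
    (hμ : ContDiffOn ℝ 3 μ s) (hV : ContDiffOn ℝ 3 V s)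
    (hμpos : ∀ x ∈ s, 0 < μ x) (hVpos : ∀ x ∈ s, 0 < V x)
    (hV' : ∀ x ∈ s, 0 < deriv V x) :
    ∀ x ∈ s,
      deriv (SFun μ V) x = -2 * NFun μ V x ∧
      -deriv (SFun μ V) x / deriv (hFun V) x = (2 / deriv (hFun V) x) * NFun μ V x := by
  intro x hx
  have hxs := hs.mem_nhds hx
  have hm : ContDiffOn ℝ 3 (fun y => √(μ y)) s := hμ.sqrt fun y hy => (hμpos y hy).ne'
  have hq : ContDiffOn ℝ 2 (fun y => V y / (deriv V y) ^ 2) s :=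
    (hV.of_le (by norm_num)).div ((hV.deriv_of_isOpen (m := 2) hs (by norm_num)).pow 2)
      fun y hy => pow_ne_zero 2 (hV' y hy).ne'
  have d₁ : DifferentiableAt ℝ (deriv fun y => (V y / (deriv V y) ^ 2) * √(μ y)) x :=
    (((hq.mul (hm.of_le (by norm_num))).deriv_of_isOpen (m := 1) hs
      (by norm_num)).differentiableOn (by norm_num)).differentiableAt hxs
  have d₂ : DifferentiableAt ℝ
      (fun y => (V y / (deriv V y) ^ 2) * deriv (fun z => √(μ z)) y) x :=
    ((hq.mul (hm.deriv_of_isOpen (m := 2) hs (by norm_num))).differentiableOn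
      (by norm_num)).differentiableAt hxs
  have key : deriv (SFun μ V) x = -2 * NFun μ V x :=
    (((d₁.hasDerivAt.fun_add d₂.hasDerivAt).const_mul (-2)).congr_of_eventuallyEq
      (Filter.eventually_of_mem hxs fun y hy =>
        SFun_eq_neg_two_mul hs (hμ.differentiableOn (by norm_num)) (hV.of_le (by norm_num))
          hμpos hVpos hV' hy)).deriv
  refine ⟨key, ?_⟩
  rw [key]
  ring
end

section
/- Let μ(x) = (1+x²)^(−3) and V(x) = x²/(2(1+x²)) (the case a₃ = 1 of the Liénard II example with f(x) = −3x/(1+x²), g(x) = x + x³). Then N(x) = 0 for every x ≠ 0, where N = ((V/V'²)·√μ)'' + ((V/V'²)·(√μ)')'; hence the period function is constant in energy and the system is isochronous. -/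
lemma deriv_sq_div_two_mul_one_add_sq (x : ℝ) :
    deriv (fun y : ℝ => y ^ 2 / (2 * (1 + y ^ 2))) x = x / (1 + x ^ 2) ^ 2 := by
  have hx : (1 + x ^ 2 : ℝ) ≠ 0 := by positivity
  have h := (hasDerivAt_pow 2 x).div (((hasDerivAt_pow 2 x).const_add 1).const_mul 2)
    (mul_ne_zero two_ne_zero hx)
  refine HasDerivAt.deriv (h.congr_deriv ?_)
  field_simp
  push_cast
  ring

lemma hasDerivAt_sqrt_inv_one_add_sq_cubed (x : ℝ) :
    HasDerivAt (fun y : ℝ => Real.sqrt ((1 + y ^ 2) ^ 3)⁻¹)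
      (-3 * x / (1 + x ^ 2) * Real.sqrt ((1 + x ^ 2) ^ 3)⁻¹) x := by
  have hx : (1 + x ^ 2 : ℝ) ≠ 0 := by positivity
  have hpos : (0 : ℝ) < ((1 + x ^ 2) ^ 3)⁻¹ := by positivity
  have h := ((((hasDerivAt_pow 2 x).const_add 1).pow 3).inv (pow_ne_zero 3 hx)).sqrt hpos.ne'
  refine h.congr_deriv ?_
  have hs := (Real.sqrt_pos.mpr hpos).ne'
  have hsq := Real.sq_sqrt hpos.le
  simp only [Pi.inv_apply, Pi.pow_apply] at *
  rw [div_eq_iff (mul_ne_zero two_ne_zero hs)]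
  set w := Real.sqrt ((1 + x ^ 2) ^ 3)⁻¹
  calc _ = 2 * (-3 * x / (1 + x ^ 2)) * ((1 + x ^ 2) ^ 3)⁻¹ := by
        field_simp
        push_cast
        ring
    _ = _ := by rw [← hsq]; ring

/-- For `μ(x) = (1+x²)⁻³` and `V(x) = x²/(2(1+x²))` (the case `a₃ = 1` of the
Liénard II example) one has `N(x) = 0` for all `x ≠ 0`: the system is
isochronous. -/
theorem lienard_II_example_isochronous
    (μ V : ℝ → ℝ)
    (hμ : ∀ x, μ x = ((1 + x ^ 2) ^ 3)⁻¹)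
    (hV : ∀ x, V x = x ^ 2 / (2 * (1 + x ^ 2))) :
    ∀ x : ℝ, x ≠ 0 → NFun μ V x = 0 := by
  obtain rfl : μ = fun x => ((1 + x ^ 2) ^ 3)⁻¹ := funext hμ
  obtain rfl : V = fun x => x ^ 2 / (2 * (1 + x ^ 2)) := funext hV
  intro x hx
  have ratio (y : ℝ) (hy : y ≠ 0) :
      y ^ 2 / (2 * (1 + y ^ 2)) / (y / (1 + y ^ 2) ^ 2) ^ 2 = (1 + y ^ 2) ^ 3 / 2 := by
    have : (1 + y ^ 2 : ℝ) ≠ 0 := by positivity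
    field_simp
  simp only [NFun, deriv_sq_div_two_mul_one_add_sq,
    (hasDerivAt_sqrt_inv_one_add_sq_cubed _).deriv]
  rw [← eq_neg_iff_add_eq_zero, ← deriv.fun_neg]
  refine Filter.EventuallyEq.deriv_eq ?_
  filter_upwards [isOpen_ne.mem_nhds hx] with y hy
  have hprod : (fun z : ℝ => z ^ 2 / (2 * (1 + z ^ 2)) / (z / (1 + z ^ 2) ^ 2) ^ 2
      * Real.sqrt ((1 + z ^ 2) ^ 3)⁻¹)
      =ᶠ[nhds y] fun z => (1 + z ^ 2) ^ 3 / 2 * Real.sqrt ((1 + z ^ 2) ^ 3)⁻¹ := by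
    filter_upwards [isOpen_ne.mem_nhds hy] with z hz
    rw [ratio z hz]
  have h := ((((hasDerivAt_pow 2 y).const_add 1).fun_pow 3).div_const 2).fun_mul
    (hasDerivAt_sqrt_inv_one_add_sq_cubed y)
  rw [hprod.deriv_eq, h.deriv, ratio y hy]
  have : (1 + y ^ 2 : ℝ) ≠ 0 := by positivity
  field_simp
  push_cast
  ring
end

section
/- Let f, g : ℝ → ℝ be smooth, F' = f with F(0)=0, P = g' + g·f, W = 3P² − g·P', and let Φ be an antiderivative of e^F. Define D by 2D = (3P + 2P'e^{−F}Φ)/W on the set where W ≠ 0. Then wherever W ≠ 0 and P ≠ 0, 2·P·W²·e^{F}·D' = (3P²P'' − 3f·P²P' − 5P·P'²)·( g·e^{F} + 2P·Φ ). In particular D'(x) = 0 if and only if (3P²P'f + 5PP'² − 3P²P'')·(g e^F + 2PΦ) = 0 at x. -/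
/-- For `D` defined by `2D = (3P + 2P'e^{−F}Φ)/W` on `{W ≠ 0}` one has
`2PW²e^F D' = (3P²P'' − 3fP²P' − 5PP'²)(ge^F + 2PΦ)` wherever `W ≠ 0` and
`P ≠ 0`; in particular `D' = 0` iff `(3P²P'f + 5PP'² − 3P²P'')(ge^F + 2PΦ) = 0`. -/
theorem isochronicity_D_constancy
    (f g : ℝ → ℝ) (hf : ContDiff ℝ (⊤ : ℕ∞) f) (hg : ContDiff ℝ (⊤ : ℕ∞) g)
    (F : ℝ → ℝ) (hF : ∀ x, HasDerivAt F (f x) x) (hF0 : F 0 = 0)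
    (P W : ℝ → ℝ)
    (hP : ∀ x, P x = deriv g x + g x * f x)
    (hW : ∀ x, W x = 3 * (P x) ^ 2 - g x * deriv P x)
    (Φ : ℝ → ℝ) (hΦ : ∀ x, HasDerivAt Φ (Real.exp (F x)) x)
    (D : ℝ → ℝ)
    (hD : ∀ x, W x ≠ 0 →
      2 * D x = (3 * P x + 2 * deriv P x * Real.exp (-F x) * Φ x) / W x) :
    ∀ x : ℝ, W x ≠ 0 → P x ≠ 0 →
      (2 * P x * (W x) ^ 2 * Real.exp (F x) * deriv D x
        = (3 * (P x) ^ 2 * deriv (deriv P) x - 3 * f x * (P x) ^ 2 * deriv P x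
            - 5 * P x * (deriv P x) ^ 2)
          * (g x * Real.exp (F x) + 2 * P x * Φ x)) ∧
      (deriv D x = 0 ↔
        (3 * (P x) ^ 2 * deriv P x * f x + 5 * P x * (deriv P x) ^ 2
            - 3 * (P x) ^ 2 * deriv (deriv P) x)
          * (g x * Real.exp (F x) + 2 * P x * Φ x) = 0) := by
  have hP_smooth : ContDiff ℝ (⊤ : ℕ∞) P := by
    rw [show P = fun x => deriv g x + g x * f x from funext hP]
    exact (contDiff_infty_iff_deriv.mp hg).2.add (hg.mul hf)
  have hP'_smooth : ContDiff ℝ (⊤ : ℕ∞) (deriv P) := (contDiff_infty_iff_deriv.mp hP_smooth).2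
  have dg : ∀ x, HasDerivAt g (deriv g x) x := fun x =>
    (hg.differentiable (by simp) x).hasDerivAt
  have dP : ∀ x, HasDerivAt P (deriv P x) x := fun x =>
    (hP_smooth.differentiable (by simp) x).hasDerivAt
  have dP' : ∀ x, HasDerivAt (deriv P) (deriv (deriv P) x) x := fun x =>
    (hP'_smooth.differentiable (by simp) x).hasDerivAt
  have dW : ∀ x, HasDerivAt W
      (6 * P x * deriv P x - (deriv g x * deriv P x + g x * deriv (deriv P) x)) x := by
    intro x
    rw [show W = fun x => 3 * (P x) ^ 2 - g x * deriv P x from funext hW]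
    refine ((((dP x).fun_pow 2).const_mul 3).fun_sub ((dg x).fun_mul (dP' x))).congr_deriv ?_
    push_cast
    ring
  intro x hWx hPx
  have dD := (((((dP x).const_mul 3).fun_add
    ((((dP' x).const_mul 2).fun_mul (hF x).fun_neg.exp).fun_mul (hΦ x))).fun_div
      (dW x) hWx).div_const 2).congr_of_eventuallyEq (f₁ := D) (by
    filter_upwards [(dW x).continuousAt.eventually_ne hWx] with y hy
    rw [← hD y hy]
    ring)
  have hE : Real.exp (-F x) * Real.exp (F x) = 1 := by
    rw [← Real.exp_add]
    simp
  have hg' : deriv g x = P x - g x * f x := by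
    rw [hP x]
    ring
  have key : 2 * P x * (W x) ^ 2 * Real.exp (F x) * deriv D x
      = (3 * (P x) ^ 2 * deriv (deriv P) x - 3 * f x * (P x) ^ 2 * deriv P x
          - 5 * P x * (deriv P x) ^ 2)
        * (g x * Real.exp (F x) + 2 * P x * Φ x) := by
    rw [dD.deriv, hg']
    generalize Real.exp (-F x) = e at *
    generalize Real.exp (F x) = E at *
    have hE0 : E ≠ 0 := right_ne_zero_of_mul_eq_one hE
    obtain rfl : e = E⁻¹ := eq_inv_of_mul_eq_one_left hE
    field_simp
    rw [hW x]
    ring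
  refine ⟨key, ?_⟩
  have hc : 2 * P x * (W x) ^ 2 * Real.exp (F x) ≠ 0 := by
    have := Real.exp_ne_zero (F x)
    positivity
  rw [← mul_eq_zero_iff_left hc, key, ← neg_eq_zero, ← neg_mul]
  ring_nf
end
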